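/- (Weber's formula.) Let (n_1, …, n_7) be an Aronhold set of odd characteristics in genus 3, let m_1 = n_1 + ⋯ + n_7 (mod 2) and m_2 = n_1 + n_2 + n_3 (mod 2), and assume m_1 ≠ m_2. For 1 ≤ i < j ≤ 7 set n_{ij} := m_1 + n_i + n_j (mod 2), and represent every characteristic by its entries in {0,1}. Let τ ∈ H_3 be such that θ_m(τ) ≠ 0 for every even characteristic m. Then θ_{m_1}(τ)⁴ · D(n_{23}, n_{13}, n_{12})(τ) · D(n_{23}, n_3, n_2)(τ) · D(n_3, n_{13}, n_1)(τ) · D(n_2, n_1, n_{12})(τ) = e(m_1 + m_2) · θ_{m_2}(τ)⁴ · D(n_1, n_2, n_3)(τ) · D(n_1, n_{12}, n_{13})(τ) · D(n_{12}, n_2, n_{23})(τ) · D(n_{13}, n_{23}, n_3)(τ), where m_1 + m_2 is computed mod 2. -/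

import Mathlib

open scoped BigOperators
open Complex Matrix

noncomputable section

/-- The Siegel upper half-space: complex symmetric `g × g` matrices with
positive definite imaginary part. -/
def IsSiegel {g : ℕ} (τ : Matrix (Fin g) (Fin g) ℂ) : Prop :=
  τ.IsSymm ∧ Matrix.PosDef (Matrix.of fun i j => (τ i j).im)

/-- The `p`-th term of the Riemann theta series with characteristic `m`. -/
def thetaTerm {g : ℕ} (m : (Fin g → ℤ) × (Fin g → ℤ))
    (τ : Matrix (Fin g) (Fin g) ℂ) (z : Fin g → ℂ) (p : Fin g → ℤ) : ℂ :=
  Complex.exp ((Real.pi : ℂ) * Complex.I *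
      (∑ i, ∑ j, ((p i : ℂ) + (m.1 i : ℂ) / 2) * τ i j * ((p j : ℂ) + (m.1 j : ℂ) / 2))
    + 2 * (Real.pi : ℂ) * Complex.I *
      (∑ i, ((p i : ℂ) + (m.1 i : ℂ) / 2) * (z i + (m.2 i : ℂ) / 2)))

/-- The Riemann theta function with characteristic `m`. -/
def theta {g : ℕ} (m : (Fin g → ℤ) × (Fin g → ℤ))
    (τ : Matrix (Fin g) (Fin g) ℂ) (z : Fin g → ℂ) : ℂ :=
  ∑' p : Fin g → ℤ, thetaTerm m τ z p

/-- The gradient `grad_z θ_m(τ, z)|_{z = 0}`. -/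
def thetaGrad {g : ℕ} (m : (Fin g → ℤ) × (Fin g → ℤ))
    (τ : Matrix (Fin g) (Fin g) ℂ) : Fin g → ℂ :=
  fun j => fderiv ℂ (fun z => theta m τ z) 0 (Pi.single j 1)

/-- The Jacobian determinant `D(n₁, …, n_g)(τ)`. -/
def jacDet {g : ℕ} (n : Fin g → (Fin g → ℤ) × (Fin g → ℤ))
    (τ : Matrix (Fin g) (Fin g) ℂ) : ℂ :=
  ((Real.pi : ℂ) ^ g)⁻¹ * Matrix.det (Matrix.of fun i j => thetaGrad (n i) τ j)

/-- A characteristic mod 2 in genus `g`. -/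
abbrev ThetaChar (g : ℕ) := (Fin g → ZMod 2) × (Fin g → ZMod 2)

/-- Lift of a mod-2 characteristic to the integer representative with entries in `{0,1}`. -/
def charLift {g : ℕ} (m : ThetaChar g) : (Fin g → ℤ) × (Fin g → ℤ) :=
  (fun i => ((m.1 i).val : ℤ), fun i => ((m.2 i).val : ℤ))

/-- `m'·m''` computed on the `{0,1}` representatives. -/
def charDot {g : ℕ} (m : ThetaChar g) : ℕ := ∑ i, (m.1 i).val * (m.2 i).val

/-- The parity `e(m) = (-1)^{m'·m''}` of a characteristic. -/
def charParity {g : ℕ} (m : ThetaChar g) : ℤ := (-1) ^ charDot m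

def IsOddChar {g : ℕ} (m : ThetaChar g) : Prop := charParity m = -1

def IsEvenChar {g : ℕ} (m : ThetaChar g) : Prop := charParity m = 1

/-- A tuple of characteristics is azygetic if
`e(nᵢ)e(nⱼ)e(nₖ)e(nᵢ+nⱼ+nₖ) = -1` for all `i < j < k`. -/
def Azygetic {g k : ℕ} (n : Fin k → ThetaChar g) : Prop :=
  ∀ i j l : Fin k, i < j → j < l →
    charParity (n i) * charParity (n j) * charParity (n l) *
      charParity (n i + n j + n l) = -1

/-- An Aronhold set in genus 3: seven pairwise distinct odd characteristics such
that, together with their sum, they form an azygetic 8-tuple. -/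
def IsAronhold (n : Fin 7 → ThetaChar 3) : Prop :=
  Function.Injective n ∧ (∀ i, IsOddChar (n i)) ∧
    Azygetic (Fin.snoc n (∑ i, n i) : Fin 8 → ThetaChar 3)

/-- The standard symplectic form matrix `J = (0 I; -I 0)` over a ring. -/
def Jmat (g : ℕ) (R : Type*) [Ring R] :
    Matrix (Fin g ⊕ Fin g) (Fin g ⊕ Fin g) R :=
  Matrix.fromBlocks 0 1 (-1) 0

/-- The blocks `(a b; c d)` form a symplectic matrix over `R`. -/
def IsSymplectic {g : ℕ} {R : Type*} [Ring R]
    (a b c d : Matrix (Fin g) (Fin g) R) : Prop :=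
  (Matrix.fromBlocks a b c d)ᵀ * Jmat g R * Matrix.fromBlocks a b c d = Jmat g R

/-- The action of `Sp(2g, ℤ)` on mod-2 characteristics. -/
def charAction {g : ℕ} (a b c d : Matrix (Fin g) (Fin g) ℤ) (m : ThetaChar g) : ThetaChar g :=
  (fun i => (∑ j, ((d i j : ZMod 2)) * m.1 j) - (∑ j, ((c i j : ZMod 2)) * m.2 j)
      + (((c * dᵀ) i i : ℤ) : ZMod 2),
   fun i => -(∑ j, ((b i j : ZMod 2)) * m.1 j) + (∑ j, ((a i j : ZMod 2)) * m.2 j)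
      + (((a * bᵀ) i i : ℤ) : ZMod 2))

/-- The Jacobian determinant in genus 3, for three mod-2 odd characteristics. -/
def D3 (n1 n2 n3 : ThetaChar 3) (τ : Matrix (Fin 3) (Fin 3) ℂ) : ℂ :=
  jacDet ![charLift n1, charLift n2, charLift n3] τ

end

/-! ### Convergence of the theta series -/

lemma exists_pos_mul_norm_sq_le {g : ℕ} {Y : Matrix (Fin g) (Fin g) ℝ} (hY : Y.PosDef) :
    ∃ c : ℝ, 0 < c ∧ ∀ x : Fin g → ℝ, c * ‖x‖ ^ 2 ≤ ∑ i, ∑ j, x i * Y i j * x j := by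
  set Q : (Fin g → ℝ) → ℝ := fun x => ∑ i, ∑ j, x i * Y i j * x j with hQ
  have hpos : ∀ x : Fin g → ℝ, x ≠ 0 → 0 < Q x := fun x hx => by
    have := hY.dotProduct_mulVec_pos hx
    simpa [hQ, dotProduct, mulVec, Finset.mul_sum, mul_assoc] using this
  have hcont : Continuous Q := by fun_prop
  have hsmul : ∀ (t : ℝ) x, Q (t • x) = t ^ 2 * Q x := fun t x => by
    simp only [hQ, Pi.smul_apply, smul_eq_mul, Finset.mul_sum]
    exact Finset.sum_congr rfl fun i _ => Finset.sum_congr rfl fun j _ => by ring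
  rcases (Metric.sphere (0 : Fin g → ℝ) 1).eq_empty_or_nonempty with he | hne
  · refine ⟨1, one_pos, fun x => ?_⟩
    have hx : x = 0 := by
      by_contra hx
      have : ‖x‖⁻¹ • x ∈ Metric.sphere (0 : Fin g → ℝ) 1 := by
        simp [norm_smul, norm_ne_zero_iff.mpr hx]
      simp [he] at this
    simp [hx]
  · obtain ⟨y, hy, hmin⟩ := (isCompact_sphere (0 : Fin g → ℝ) 1).exists_isMinOn hne
      hcont.continuousOn
    have hy0 : y ≠ 0 := by
      rintro rfl
      simp at hy
    refine ⟨Q y, hpos y hy0, fun x => ?_⟩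
    by_cases hx : x = 0
    · simp [hx]
    have hn : ‖x‖ ≠ 0 := norm_ne_zero_iff.mpr hx
    have hmem : ‖x‖⁻¹ • x ∈ Metric.sphere (0 : Fin g → ℝ) 1 := by
      simp [norm_smul, hn]
    have h : Q y ≤ Q (‖x‖⁻¹ • x) := hmin hmem
    rw [hsmul] at h
    calc Q y * ‖x‖ ^ 2 ≤ (‖x‖⁻¹ ^ 2 * Q x) * ‖x‖ ^ 2 := by gcongr
      _ = Q x := by field_simp

lemma summable_pi_prod {g : ℕ} {α : Type*} {f : α → ℝ} (hf : Summable f) (h0 : ∀ a, 0 ≤ f a) :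
    Summable fun p : Fin g → α => ∏ i, f (p i) := by
  induction g with
  | zero => exact (hasSum_fintype _).summable
  | succ g ih =>
    have h := hf.mul_of_nonneg ih h0 fun p => Finset.prod_nonneg fun i _ => h0 _
    rw [← (Fin.consEquiv fun _ : Fin (g + 1) => α).summable_iff]
    refine h.congr fun x => ?_
    simp [Fin.prod_univ_succ, Fin.consEquiv]

lemma summable_exp_neg_sum_abs (g : ℕ) :
    Summable fun p : Fin g → ℤ => Real.exp (-∑ i, |(p i : ℝ)|) := by
  have h1 : Summable fun n : ℤ => Real.exp (-|(n : ℝ)|) := by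
    have : Summable fun n : ℕ => Real.exp (-(n : ℝ)) := Real.summable_exp_neg_nat
    exact Summable.of_nat_of_neg (by simpa using this) (by simpa using this)
  refine (summable_pi_prod h1 fun _ => (Real.exp_pos _).le).congr fun p => ?_
  rw [← Real.exp_sum, Finset.sum_neg_distrib]

/-- The vector `p + m'/2` over which the theta series is summed. -/
noncomputable def thetaShift {g : ℕ} (m : (Fin g → ℤ) × (Fin g → ℤ)) (p : Fin g → ℤ) (i : Fin g) : ℂ :=
  (p i : ℂ) + (m.1 i : ℂ) / 2

lemma exists_thetaTerm_bound {g : ℕ} {τ : Matrix (Fin g) (Fin g) ℂ} (hτ : IsSiegel τ)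
    (m : (Fin g → ℤ) × (Fin g → ℤ)) :
    ∃ C : ℝ, ∀ z ∈ Metric.ball (0 : Fin g → ℂ) 1, ∀ p : Fin g → ℤ,
      ‖thetaTerm m τ z p‖ ≤ C * Real.exp (-∑ i, |(p i : ℝ)|) ∧
      ‖thetaTerm m τ z p‖ * ∑ i, ‖thetaShift m p i‖ ≤ C * Real.exp (-∑ i, |(p i : ℝ)|) := by
  obtain ⟨c, hc, hQ⟩ := exists_pos_mul_norm_sq_le hτ.2
  have hπ := Real.pi_pos
  set B : ℝ := (2 * Real.pi + 2) * g with hB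
  refine ⟨Real.exp (B ^ 2 / (4 * (Real.pi * c)) + ∑ i, |(m.1 i : ℝ) / 2|), fun z hz p => ?_⟩
  set X : Fin g → ℝ := fun i => p i + m.1 i / 2 with hX
  have hsX : ∀ i, thetaShift m p i = (X i : ℂ) := fun i => by simp [thetaShift, hX]
  have hre : (Real.pi * Complex.I *
      (∑ i, ∑ j, ((p i : ℂ) + (m.1 i : ℂ) / 2) * τ i j * ((p j : ℂ) + (m.1 j : ℂ) / 2))
      + 2 * (Real.pi : ℂ) * Complex.I *
      (∑ i, ((p i : ℂ) + (m.1 i : ℂ) / 2) * (z i + (m.2 i : ℂ) / 2))).re =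
      -Real.pi * (∑ i, ∑ j, X i * (τ i j).im * X j) - 2 * Real.pi * ∑ i, X i * (z i).im := by
    have e1 : ∀ i, (p i : ℂ) + (m.1 i : ℂ) / 2 = (X i : ℂ) := fun i => by simp [hX]
    have e2 : ∀ i, (z i + (m.2 i : ℂ) / 2).im = (z i).im := fun i => by
      have : (m.2 i : ℂ) / 2 = (((m.2 i : ℝ) / 2 : ℝ) : ℂ) := by simp
      rw [this, Complex.add_im, Complex.ofReal_im, add_zero]
    simp only [e1]
    simp [Complex.mul_re, Complex.mul_im, Complex.im_sum, e2]
    ring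
  have hXn : ∀ i, |X i| ≤ ‖X‖ := fun i => by simpa using norm_le_pi_norm X i
  have hsum : ∑ i, |X i| ≤ g * ‖X‖ := by
    simpa using Finset.sum_le_sum fun i (_ : i ∈ Finset.univ) => hXn i
  have hlin : -(∑ i, X i * (z i).im) ≤ g * ‖X‖ := by
    rw [← Finset.sum_neg_distrib]
    refine (Finset.sum_le_sum fun i _ => ?_).trans hsum
    have hzi : |(z i).im| ≤ 1 := (Complex.abs_im_le_norm _).trans
      ((norm_le_pi_norm z i).trans (mem_ball_zero_iff.mp hz).le)
    calc -(X i * (z i).im) ≤ |X i * (z i).im| := neg_le_abs _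
      _ = |X i| * |(z i).im| := abs_mul _ _
      _ ≤ |X i| * 1 := by gcongr
      _ = |X i| := mul_one _
  have hp : ∑ i, |(p i : ℝ)| ≤ ∑ i, |X i| + ∑ i, |(m.1 i : ℝ) / 2| := by
    rw [← Finset.sum_add_distrib]
    refine Finset.sum_le_sum fun i _ => ?_
    have : (p i : ℝ) = X i - m.1 i / 2 := by simp [hX]
    rw [this]
    exact abs_sub _ _
  have hsq : -(Real.pi * c) * ‖X‖ ^ 2 + B * ‖X‖ ≤ B ^ 2 / (4 * (Real.pi * c)) := by
    have hpc : 0 < Real.pi * c := by positivity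
    rw [le_div_iff₀ (by positivity)]
    nlinarith [sq_nonneg (2 * (Real.pi * c) * ‖X‖ - B)]
  have hkey : ‖thetaTerm m τ z p‖ * Real.exp (∑ i, |X i|) ≤
      Real.exp (B ^ 2 / (4 * (Real.pi * c)) + ∑ i, |(m.1 i : ℝ) / 2|) *
        Real.exp (-∑ i, |(p i : ℝ)|) := by
    rw [thetaTerm, Complex.norm_exp, hre, ← Real.exp_add, ← Real.exp_add, Real.exp_le_exp]
    have := hQ X
    have h1 := mul_le_mul_of_nonneg_left this hπ.le
    have h2 := mul_le_mul_of_nonneg_left hlin hπ.le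
    simp only [Matrix.of_apply] at h1
    nlinarith
  have hS0 : 0 ≤ ∑ i, |X i| := Finset.sum_nonneg fun _ _ => abs_nonneg _
  constructor
  · refine le_trans ?_ hkey
    exact le_mul_of_one_le_right (norm_nonneg _) (Real.one_le_exp hS0)
  · refine le_trans ?_ hkey
    gcongr
    simp only [hsX, Complex.norm_real, Real.norm_eq_abs]
    linarith [Real.add_one_le_exp (∑ i, |X i|)]

lemma summable_norm_thetaTerm {g : ℕ} {τ : Matrix (Fin g) (Fin g) ℂ} (hτ : IsSiegel τ)
    (m : (Fin g → ℤ) × (Fin g → ℤ)) : Summable fun p => ‖thetaTerm m τ 0 p‖ := by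
  obtain ⟨C, hC⟩ := exists_thetaTerm_bound hτ m
  exact Summable.of_nonneg_of_le (fun _ => norm_nonneg _)
    (fun p => (hC 0 (by simp) p).1) ((summable_exp_neg_sum_abs g).mul_left C)

lemma summable_norm_thetaShift_mul_thetaTerm {g : ℕ} {τ : Matrix (Fin g) (Fin g) ℂ}
    (hτ : IsSiegel τ) (m : (Fin g → ℤ) × (Fin g → ℤ)) (j : Fin g) :
    Summable fun p => ‖thetaShift m p j * thetaTerm m τ 0 p‖ := by
  obtain ⟨C, hC⟩ := exists_thetaTerm_bound hτ m
  refine Summable.of_nonneg_of_le (fun _ => norm_nonneg _)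
    (fun p => le_trans ?_ (hC 0 (by simp) p).2) ((summable_exp_neg_sum_abs g).mul_left C)
  rw [norm_mul, mul_comm]
  gcongr
  exact Finset.single_le_sum (f := fun i => ‖thetaShift m p i‖) (fun _ _ => norm_nonneg _)
    (Finset.mem_univ j)

lemma thetaGrad_eq_tsum {g : ℕ} {τ : Matrix (Fin g) (Fin g) ℂ} (hτ : IsSiegel τ)
    (m : (Fin g → ℤ) × (Fin g → ℤ)) (j : Fin g) :
    thetaGrad m τ j =
      2 * Real.pi * Complex.I * ∑' p, thetaShift m p j * thetaTerm m τ 0 p := by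
  obtain ⟨C, hC⟩ := exists_thetaTerm_bound hτ m
  set K : ℂ := 2 * Real.pi * Complex.I with hK
  set D : (Fin g → ℤ) → (Fin g → ℂ) → ((Fin g → ℂ) →L[ℂ] ℂ) := fun p z =>
    thetaTerm m τ z p • K • ∑ i, thetaShift m p i • ContinuousLinearMap.proj (R := ℂ) i with hD
  have hderiv : ∀ p z, HasFDerivAt (fun z => thetaTerm m τ z p) (D p z) z := fun p z => by
    have h1 : HasFDerivAt (fun z : Fin g → ℂ =>
        ∑ i, ((p i : ℂ) + (m.1 i : ℂ) / 2) * (z i + (m.2 i : ℂ) / 2))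
        (∑ i, thetaShift m p i • ContinuousLinearMap.proj (R := ℂ) (φ := fun _ : Fin g => ℂ) i) z := by
      refine HasFDerivAt.fun_sum fun i _ => ?_
      exact (((ContinuousLinearMap.proj (R := ℂ) (φ := fun _ : Fin g => ℂ) i).hasFDerivAt).add_const
        _).const_mul _
    exact ((h1.const_mul K).const_add _).cexp
  have hu : Summable fun p : Fin g → ℤ => ‖K‖ * (C * Real.exp (-∑ i, |(p i : ℝ)|)) :=
    ((summable_exp_neg_sum_abs g).mul_left C).mul_left _
  have hbound : ∀ p, ∀ z ∈ Metric.ball (0 : Fin g → ℂ) 1,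
      ‖D p z‖ ≤ ‖K‖ * (C * Real.exp (-∑ i, |(p i : ℝ)|)) := fun p z hz => by
    refine le_trans ?_ (mul_le_mul_of_nonneg_left (hC z hz p).2 (norm_nonneg K))
    rw [hD]
    simp only [norm_smul]
    rw [mul_left_comm]
    gcongr
    refine (norm_sum_le _ _).trans (Finset.sum_le_sum fun i _ => ?_)
    rw [norm_smul]
    refine mul_le_of_le_one_right (norm_nonneg _) ?_
    exact ContinuousLinearMap.opNorm_le_bound _ zero_le_one fun v => by
      simpa using norm_le_pi_norm v i
  have h0 : (0 : Fin g → ℂ) ∈ Metric.ball (0 : Fin g → ℂ) 1 := by simp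
  have hmain := hasFDerivAt_tsum_of_isPreconnected hu Metric.isOpen_ball
    (convex_ball (0 : Fin g → ℂ) 1).isPreconnected (fun p z _ => hderiv p z) hbound h0
    (summable_norm_thetaTerm hτ m).of_norm h0
  have hsumD : Summable fun p => D p 0 :=
    Summable.of_norm_bounded hu fun p => hbound p 0 h0
  have hfd : fderiv ℂ (fun z => theta m τ z) 0 = ∑' p, D p 0 := hmain.fderiv
  have happly := (ContinuousLinearMap.apply ℂ ℂ (Pi.single j (1 : ℂ) : Fin g → ℂ)).map_tsum hsumD
  simp only [ContinuousLinearMap.apply_apply] at happly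
  rw [thetaGrad, hfd, happly, ← tsum_mul_left]
  refine tsum_congr fun p => ?_
  simp [hD, Pi.single_apply]
  ring

/-! ### Signs and parities -/

/-- The character `a ↦ (-1) ^ a` of `ZMod 2`. -/
def zmodSign (a : ZMod 2) : ℤ := (-1) ^ a.val

lemma zmodSign_add (a b : ZMod 2) : zmodSign (a + b) = zmodSign a * zmodSign b := by
  revert a b; decide

lemma zmodSign_mul_self (a : ZMod 2) : zmodSign a * zmodSign a = 1 := by
  revert a; decide

lemma zmodSign_natCast (k : ℕ) : zmodSign (k : ZMod 2) = (-1) ^ k := by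
  induction k with
  | zero => rfl
  | succ k ih =>
    rw [Nat.cast_succ, zmodSign_add, ih, pow_succ]
    rfl

lemma exp_pi_mul_I_mul_intCast (k : ℤ) :
    Complex.exp (Real.pi * Complex.I * k) = (zmodSign (k : ZMod 2) : ℂ) := by
  rw [mul_comm, Complex.exp_int_mul, Complex.exp_pi_mul_I]
  rcases Int.even_or_odd k with h | h
  · rw [h.neg_one_zpow, (ZMod.intCast_eq_zero_iff_even).mpr h]
    simp [zmodSign]
  · rw [h.neg_one_zpow, (ZMod.intCast_eq_one_iff_odd).mpr h]
    simp [zmodSign, ZMod.val_one]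

/-- The quadratic form `m'·m''` on characteristics mod 2. -/
def charQuad {g : ℕ} (m : ThetaChar g) : ZMod 2 := ∑ i, m.1 i * m.2 i

/-- The reduction mod 2 of an integral characteristic. -/
def charRed {g : ℕ} (m : (Fin g → ℤ) × (Fin g → ℤ)) : ThetaChar g :=
  (fun i => (m.1 i : ZMod 2), fun i => (m.2 i : ZMod 2))

lemma charRed_charLift {g : ℕ} (m : ThetaChar g) : charRed (charLift m) = m := by
  ext i <;> simp [charRed, charLift]

lemma charRed_add {g : ℕ} (m n : (Fin g → ℤ) × (Fin g → ℤ)) :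
    charRed (m + n) = charRed m + charRed n := by
  ext i <;> simp [charRed]

lemma charParity_eq {g : ℕ} (m : ThetaChar g) : charParity m = zmodSign (charQuad m) := by
  rw [charParity, ← zmodSign_natCast, charDot, charQuad]
  simp

lemma thetaTerm_neg {g : ℕ} (m : (Fin g → ℤ) × (Fin g → ℤ)) (τ : Matrix (Fin g) (Fin g) ℂ)
    (p : Fin g → ℤ) : thetaTerm m τ 0 (-m.1 - p) =
      zmodSign (charQuad (charRed m)) * thetaTerm m τ 0 p := by
  have hk : ((∑ i, (m.1 i * m.2 i + 2 * (p i * m.2 i)) : ℤ) : ZMod 2) =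
      charQuad (charRed m) := by
    have h2 : (2 : ZMod 2) = 0 := rfl
    simp [charQuad, charRed, h2]
  have h1 : ∀ i, (((-m.1 - p) i : ℤ) : ℂ) + (m.1 i : ℂ) / 2 = -((p i : ℂ) + (m.1 i : ℂ) / 2) :=
    fun i => by simp; ring
  have h2 : zmodSign (charQuad (charRed m)) * zmodSign (charQuad (charRed m)) = 1 :=
    zmodSign_mul_self _
  have h3 : thetaTerm m τ 0 p = zmodSign (charQuad (charRed m)) *
      thetaTerm m τ 0 (-m.1 - p) := by
    rw [← hk, ← exp_pi_mul_I_mul_intCast, thetaTerm, thetaTerm, ← Complex.exp_add]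
    congr 1
    simp only [h1, neg_mul, mul_neg, neg_neg, Finset.sum_neg_distrib]
    rw [add_left_comm]
    congr 1
    push_cast
    simp only [Finset.mul_sum, ← Finset.sum_neg_distrib, ← Finset.sum_add_distrib]
    refine Finset.sum_congr rfl fun i _ => ?_
    simp
    ring
  have h4 : (zmodSign (charQuad (charRed m)) : ℂ) * zmodSign (charQuad (charRed m)) = 1 := by
    exact_mod_cast h2
  rw [h3, ← mul_assoc, h4, one_mul]

lemma thetaShift_neg {g : ℕ} (m : (Fin g → ℤ) × (Fin g → ℤ)) (p : Fin g → ℤ) (j : Fin g) :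
    thetaShift m (-m.1 - p) j = -thetaShift m p j := by
  simp [thetaShift]
  ring

lemma thetaGrad_eq_zero_of_even {g : ℕ} {m : (Fin g → ℤ) × (Fin g → ℤ)}
    {τ : Matrix (Fin g) (Fin g) ℂ} (hτ : IsSiegel τ) (h : charQuad (charRed m) = 0) :
    thetaGrad m τ = 0 := by
  funext j
  rw [thetaGrad_eq_tsum hτ]
  set S := ∑' p, thetaShift m p j * thetaTerm m τ 0 p with hS
  have h1 : S = -S := by
    conv_lhs => rw [hS, ← (Equiv.subLeft (-m.1)).tsum_eq]
    simp only [Equiv.subLeft_apply, thetaTerm_neg, thetaShift_neg, h]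
    simp [zmodSign, tsum_neg, hS]
  simp [self_eq_neg.mp h1]

lemma thetaTerm_add_two_nsmul {g : ℕ} (m k : (Fin g → ℤ) × (Fin g → ℤ))
    (τ : Matrix (Fin g) (Fin g) ℂ) (p : Fin g → ℤ) :
    thetaTerm (m + 2 • k) τ 0 p =
      zmodSign (∑ i, (m.1 i : ZMod 2) * (k.2 i : ZMod 2)) * thetaTerm m τ 0 (p + k.1) := by
  have hk : ((∑ i, (2 * (p i + k.1 i) * k.2 i + m.1 i * k.2 i) : ℤ) : ZMod 2) =
      ∑ i, (m.1 i : ZMod 2) * (k.2 i : ZMod 2) := by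
    have h2 : (2 : ZMod 2) = 0 := rfl
    simp [h2]
  have h1 : ∀ i, (p i : ℂ) + (((m + 2 • k).1 i : ℤ) : ℂ) / 2 =
      ((p + k.1) i : ℤ) + (m.1 i : ℂ) / 2 := fun i => by simp; ring
  rw [← hk, ← exp_pi_mul_I_mul_intCast, thetaTerm, thetaTerm, ← Complex.exp_add]
  congr 1
  simp only [h1]
  rw [add_left_comm]
  congr 1
  push_cast
  simp only [Finset.mul_sum, ← Finset.sum_add_distrib]
  refine Finset.sum_congr rfl fun i _ => ?_
  simp
  ring

lemma theta_add_two_nsmul {g : ℕ} (m k : (Fin g → ℤ) × (Fin g → ℤ))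
    (τ : Matrix (Fin g) (Fin g) ℂ) :
    theta (m + 2 • k) τ 0 =
      zmodSign (∑ i, (m.1 i : ZMod 2) * (k.2 i : ZMod 2)) * theta m τ 0 := by
  simp only [theta, thetaTerm_add_two_nsmul, tsum_mul_left]
  exact congrArg _ ((Equiv.addRight k.1).tsum_eq fun p => thetaTerm m τ 0 p)

lemma thetaGrad_add_two_nsmul {g : ℕ} (m k : (Fin g → ℤ) × (Fin g → ℤ))
    {τ : Matrix (Fin g) (Fin g) ℂ} (hτ : IsSiegel τ) (j : Fin g) :
    thetaGrad (m + 2 • k) τ j =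
      zmodSign (∑ i, (m.1 i : ZMod 2) * (k.2 i : ZMod 2)) * thetaGrad m τ j := by
  have h1 : ∀ p, thetaShift (m + 2 • k) p j = thetaShift m (p + k.1) j := fun p => by
    simp [thetaShift]
    ring
  rw [thetaGrad_eq_tsum hτ, thetaGrad_eq_tsum hτ]
  simp only [h1, thetaTerm_add_two_nsmul, mul_left_comm (thetaShift _ _ _), tsum_mul_left]
  rw [mul_left_comm]
  exact congrArg _ (congrArg _
    ((Equiv.addRight k.1).tsum_eq fun p => thetaShift m p j * thetaTerm m τ 0 p))

/-! ### Products of Jacobian determinants and theta constants as multiple series -/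

lemma hasSum_pi_prod {α : Type*} {n : ℕ} {f : Fin n → α → ℂ}
    (hf : ∀ i, Summable fun a => ‖f i a‖) :
    HasSum (fun P : Fin n → α => ∏ i, f i (P i)) (∏ i, ∑' a, f i a) ∧
      Summable fun P : Fin n → α => ‖∏ i, f i (P i)‖ := by
  induction n with
  | zero => exact ⟨by simp, (hasSum_fintype _).summable⟩
  | succ n ih =>
    obtain ⟨ih1, ih2⟩ := ih fun i => hf i.succ
    have hs := (summable_mul_of_summable_norm (hf 0) ih2).hasSum
    rw [← tsum_mul_tsum_of_summable_norm (hf 0) ih2, ih1.tsum_eq] at hs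
    have hfun : (fun P : Fin (n + 1) → α => ∏ i, f i (P i)) ∘
        (Fin.consEquiv fun _ : Fin (n + 1) => α) =
        fun x : α × (Fin n → α) => f 0 x.1 * ∏ i, f i.succ (x.2 i) := by
      funext x
      simp only [Function.comp_apply, Fin.prod_univ_succ]
      rfl
    rw [← (Fin.consEquiv fun _ : Fin (n + 1) => α).hasSum_iff,
      ← (Fin.consEquiv fun _ : Fin (n + 1) => α).summable_iff, hfun, Fin.prod_univ_succ]
    refine ⟨hs, ((hf 0).mul_norm ih2).congr fun x => ?_⟩
    exact congrArg norm (congrFun hfun x).symm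

/-- The product of the Jacobian determinant of the first three characteristics (up to a power of
`π`) and the fourth theta constant. -/
noncomputable def detTheta (μ : Fin 4 → (Fin 3 → ℤ) × (Fin 3 → ℤ))
    (τ : Matrix (Fin 3) (Fin 3) ℂ) : ℂ :=
  Matrix.det (Matrix.of fun i j : Fin 3 => thetaGrad (μ i.castSucc) τ j) * theta (μ 3) τ 0

/-- The general term of the quadruple series for `detTheta`. -/
noncomputable def detTerm (μ : Fin 4 → (Fin 3 → ℤ) × (Fin 3 → ℤ))
    (τ : Matrix (Fin 3) (Fin 3) ℂ) (P : Fin 4 → Fin 3 → ℤ) : ℂ :=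
  Matrix.det (Matrix.of fun i j : Fin 3 => thetaShift (μ i.castSucc) (P i.castSucc) j) *
    ∏ k, thetaTerm (μ k) τ 0 (P k)

lemma hasSum_detTerm {τ : Matrix (Fin 3) (Fin 3) ℂ} (hτ : IsSiegel τ)
    (μ : Fin 4 → (Fin 3 → ℤ) × (Fin 3 → ℤ)) :
    HasSum (fun P => (2 * Real.pi * Complex.I) ^ 3 * detTerm μ τ P) (detTheta μ τ) := by
  set F : Equiv.Perm (Fin 3) → Fin 4 → (Fin 3 → ℤ) → ℂ := fun σ =>
    Fin.snoc (α := fun _ => (Fin 3 → ℤ) → ℂ)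
      (fun i p => thetaShift (μ i.castSucc) p (σ i) * thetaTerm (μ i.castSucc) τ 0 p)
      (fun p => thetaTerm (μ 3) τ 0 p) with hF
  have hFl : ∀ σ p, F σ 3 p = thetaTerm (μ 3) τ 0 p := fun σ p => by
    simp only [hF, show (3 : Fin 4) = Fin.last 3 from rfl, Fin.snoc_last]
  have hFc : ∀ σ i p, F σ (Fin.castSucc i) p =
      thetaShift (μ i.castSucc) p (σ i) * thetaTerm (μ i.castSucc) τ 0 p := fun σ i p => by
    simp only [hF, Fin.snoc_castSucc]
  have hFs : ∀ σ i, Summable fun p => ‖F σ i p‖ := fun σ i => by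
    induction i using Fin.lastCases with
    | last =>
      simpa only [show Fin.last 3 = (3 : Fin 4) from rfl, hFl] using
        summable_norm_thetaTerm hτ (μ 3)
    | cast i =>
      simpa only [hFc] using summable_norm_thetaShift_mul_thetaTerm hτ (μ i.castSucc) (σ i)
  have hsum := (hasSum_sum (s := Finset.univ) fun σ _ => ((hasSum_pi_prod (hFs σ)).1.mul_left
    ((Equiv.Perm.sign σ : ℤ) : ℂ))).mul_left ((2 * Real.pi * Complex.I) ^ 3 : ℂ)
  have hfun : (fun P => (2 * Real.pi * Complex.I) ^ 3 * detTerm μ τ P) =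
      fun P => (2 * Real.pi * Complex.I) ^ 3 *
        ∑ σ, ((Equiv.Perm.sign σ : ℤ) : ℂ) * ∏ k, F σ k (P k) := by
    funext P
    rw [detTerm, ← Matrix.det_transpose, Matrix.det_apply', Finset.sum_mul]
    congr 1
    refine Finset.sum_congr rfl fun σ _ => ?_
    simp only [Fin.prod_univ_castSucc (n := 3), hFc, Finset.prod_mul_distrib,
      Matrix.transpose_apply, Matrix.of_apply, show Fin.last 3 = (3 : Fin 4) from rfl, hFl]
    ring
  have hval : detTheta μ τ = (2 * Real.pi * Complex.I) ^ 3 *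
      ∑ σ, ((Equiv.Perm.sign σ : ℤ) : ℂ) * ∏ k, ∑' p, F σ k p := by
    rw [detTheta, ← Matrix.det_transpose, Matrix.det_apply', Finset.sum_mul, Finset.mul_sum]
    refine Finset.sum_congr rfl fun σ _ => ?_
    simp only [Fin.prod_univ_castSucc (n := 3), hFc, Finset.prod_mul_distrib,
      Matrix.transpose_apply, Matrix.of_apply, show Fin.last 3 = (3 : Fin 4) from rfl, hFl,
      thetaGrad_eq_tsum hτ, theta]
    simp only [Finset.prod_const, Finset.card_univ, Fintype.card_fin]
    ring
  rw [hfun, hval]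
  exact hsum

/-! ### A Riemann relation for Jacobian determinants -/

lemma sum_zmodSign_eq_ite (a : Fin 3 → ZMod 2) :
    ∑ w : Fin 3 → ZMod 2, zmodSign (∑ i, a i * w i) = if a = 0 then 8 else 0 := by
  revert a
  decide

lemma thetaTerm_eq_exp {g : ℕ} (m : (Fin g → ℤ) × (Fin g → ℤ)) (τ : Matrix (Fin g) (Fin g) ℂ)
    (p : Fin g → ℤ) : thetaTerm m τ 0 p =
      Complex.exp (Real.pi * Complex.I * (∑ i, ∑ j, thetaShift m p i * τ i j * thetaShift m p j +
        ∑ i, thetaShift m p i * m.2 i)) := by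
  rw [thetaTerm]
  congr 1
  rw [mul_add]
  congr 1
  rw [Finset.mul_sum, Finset.mul_sum]
  refine Finset.sum_congr rfl fun i _ => ?_
  simp only [thetaShift, Pi.zero_apply]
  ring

/-- The integral vector `∑ₖ Pₖ + t`. -/
def shiftSum (t : Fin 3 → ℤ) (P : Fin 4 → Fin 3 → ℤ) (i : Fin 3) : ℤ := ∑ k, P k i + t i

lemma sum_thetaShift {μ : Fin 4 → (Fin 3 → ℤ) × (Fin 3 → ℤ)} {t : (Fin 3 → ℤ) × (Fin 3 → ℤ)}
    (ht : ∑ k, μ k = 2 • t) (P : Fin 4 → Fin 3 → ℤ) (i : Fin 3) :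
    ∑ k, thetaShift (μ k) (P k) i = shiftSum t.1 P i := by
  have h : ∑ k, (μ k).1 i = 2 * t.1 i := by
    simpa [Prod.fst_sum] using congrFun (congrArg Prod.fst ht) i
  have h' : ∑ k, ((μ k).1 i : ℂ) = 2 * t.1 i := by exact_mod_cast h
  simp only [thetaShift, shiftSum, Finset.sum_add_distrib, ← Finset.sum_div, h']
  push_cast
  ring

lemma detTerm_add_charLift {μ : Fin 4 → (Fin 3 → ℤ) × (Fin 3 → ℤ)}
    {t : (Fin 3 → ℤ) × (Fin 3 → ℤ)} (ht : ∑ k, μ k = 2 • t) (τ : Matrix (Fin 3) (Fin 3) ℂ)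
    (v w : Fin 3 → ZMod 2) (P : Fin 4 → Fin 3 → ℤ) :
    detTerm (fun k => μ k + charLift (v, w)) τ P =
      zmodSign (∑ i, (shiftSum t.1 P i : ZMod 2) * w i) *
        detTerm (fun k => μ k + charLift (v, 0)) τ P := by
  have h1 : ∀ k p i, thetaShift (μ k + charLift (v, w)) p i =
      thetaShift (μ k + charLift (v, 0)) p i := fun k p i => rfl
  have h2 : ((∑ i, (shiftSum t.1 P i + 2 * (v i).val) * (w i).val : ℤ) : ZMod 2) =
      ∑ i, (shiftSum t.1 P i : ZMod 2) * w i := by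
    simp [show (2 : ZMod 2) = 0 from rfl]
  have h3 : ∑ k, (μ k + charLift (v, 0)) = 2 • (t + 2 • charLift (v, 0)) := by
    rw [Finset.sum_add_distrib, ht]
    simp only [Finset.sum_const, Finset.card_univ, Fintype.card_fin]
    module
  have h4 : ∀ k, ∑ i, thetaShift (μ k + charLift (v, 0)) (P k) i *
      ((μ k + charLift (v, w)).2 i : ℂ) =
      ∑ i, thetaShift (μ k + charLift (v, 0)) (P k) i * ((μ k + charLift (v, 0)).2 i : ℂ) +
      ∑ i, thetaShift (μ k + charLift (v, 0)) (P k) i * (w i).val := fun k => by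
    rw [← Finset.sum_add_distrib]
    refine Finset.sum_congr rfl fun i _ => ?_
    simp [charLift]
    ring
  have h5 : ∑ k, ∑ i, thetaShift (μ k + charLift (v, 0)) (P k) i * ((w i).val : ℂ) =
      ((∑ i, (shiftSum t.1 P i + 2 * (v i).val) * (w i).val : ℤ) : ℂ) := by
    rw [Finset.sum_comm]
    push_cast
    refine Finset.sum_congr rfl fun i _ => ?_
    rw [← Finset.sum_mul, sum_thetaShift h3]
    simp [shiftSum, charLift, add_assoc]
  have h6 : ∏ k, thetaTerm (μ k + charLift (v, w)) τ 0 (P k) =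
      zmodSign (∑ i, (shiftSum t.1 P i : ZMod 2) * w i) *
        ∏ k, thetaTerm (μ k + charLift (v, 0)) τ 0 (P k) := by
    rw [← h2, ← exp_pi_mul_I_mul_intCast, ← h5]
    simp only [thetaTerm_eq_exp, ← Complex.exp_sum, ← Complex.exp_add, ← Finset.mul_sum,
      ← mul_add, h1, h4, Finset.sum_add_distrib]
    congr 2
    ring
  simp only [detTerm, h1, h6]
  ring

lemma sum_zmodSign_mul_detTerm {μ : Fin 4 → (Fin 3 → ℤ) × (Fin 3 → ℤ)}
    {t : (Fin 3 → ℤ) × (Fin 3 → ℤ)} (ht : ∑ k, μ k = 2 • t) (τ : Matrix (Fin 3) (Fin 3) ℂ)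
    (P : Fin 4 → Fin 3 → ℤ) :
    ∑ ν : ThetaChar 3, (zmodSign (∑ i, ν.1 i * (t.2 i + ν.2 i)) : ℂ) *
        detTerm (fun k => μ k + charLift ν) τ P =
      8 * zmodSign (∑ i, (shiftSum t.1 P i : ZMod 2) * t.2 i) *
        detTerm (fun k => μ k + charLift (fun i => (shiftSum t.1 P i : ZMod 2), 0)) τ P := by
  set S : Fin 3 → ZMod 2 := fun i => (shiftSum t.1 P i : ZMod 2) with hS
  have h1 : ∀ v w : Fin 3 → ZMod 2, (zmodSign (∑ i, v i * (t.2 i + w i)) : ℂ) *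
      detTerm (fun k => μ k + charLift (v, w)) τ P =
      zmodSign (∑ i, v i * t.2 i) * detTerm (fun k => μ k + charLift (v, 0)) τ P *
        zmodSign (∑ i, (v + S) i * w i) := fun v w => by
    rw [detTerm_add_charLift ht]
    simp only [mul_add, add_mul, Pi.add_apply, Finset.sum_add_distrib, zmodSign_add]
    push_cast
    ring
  have h2 : ∀ v : Fin 3 → ZMod 2, ∑ w : Fin 3 → ZMod 2, (zmodSign (∑ i, (v + S) i * w i) : ℂ) =
      if v = S then 8 else 0 := fun v => by
    have h3 : v + S = 0 ↔ v = S := by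
      constructor
      · intro h
        rw [eq_neg_of_add_eq_zero_left h, CharTwo.neg_eq]
      · rintro rfl
        exact CharTwo.add_self_eq_zero _
    have := sum_zmodSign_eq_ite (v + S)
    simp only [h3] at this
    exact_mod_cast this
  rw [Fintype.sum_prod_type]
  simp only [h1, ← Finset.mul_sum, h2, mul_ite, mul_zero, Finset.sum_ite_eq', Finset.mem_univ,
    if_true]
  ring

/-- The reflection `P ↦ (Pₖ - ⌈s / 2⌉)ₖ` with `s = ∑ₖ Pₖ + t`. -/
def reflectIndex (t : Fin 3 → ℤ) (P : Fin 4 → Fin 3 → ℤ) (k : Fin 4) (i : Fin 3) : ℤ :=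
  P k i - (shiftSum t P i + 1) / 2

lemma shiftSum_reflectIndex (t : Fin 3 → ℤ) (P : Fin 4 → Fin 3 → ℤ) (i : Fin 3) :
    shiftSum t (reflectIndex t P) i = shiftSum t P i - 4 * ((shiftSum t P i + 1) / 2) := by
  simp only [shiftSum, reflectIndex, Finset.sum_sub_distrib, Finset.sum_const, Finset.card_univ,
    Fintype.card_fin, nsmul_eq_mul]
  push_cast
  ring

lemma reflectIndex_involutive (t : Fin 3 → ℤ) : Function.Involutive (reflectIndex t) := by
  intro P
  funext k i
  have h := shiftSum_reflectIndex t P i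
  have h2 : reflectIndex t (reflectIndex t P) k i =
      P k i - (shiftSum t P i + 1) / 2 - (shiftSum t (reflectIndex t P) i + 1) / 2 := rfl
  omega

lemma detTerm_reflectIndex {μ : Fin 4 → (Fin 3 → ℤ) × (Fin 3 → ℤ)}
    {t : (Fin 3 → ℤ) × (Fin 3 → ℤ)} (ht : ∑ k, μ k = 2 • t) (τ : Matrix (Fin 3) (Fin 3) ℂ)
    (Q : Fin 4 → Fin 3 → ℤ) :
    zmodSign (∑ i, (shiftSum t.1 (reflectIndex t.1 Q) i : ZMod 2) * t.2 i) *
        detTerm (fun k => μ k +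
          charLift (fun i => (shiftSum t.1 (reflectIndex t.1 Q) i : ZMod 2), 0)) τ
          (reflectIndex t.1 Q) =
      -1 / 2 * ∑ l : Fin 4, detTerm (μ ∘ Equiv.swap l 3) τ (Q ∘ Equiv.swap l 3) := by
  set X : Fin 4 → Fin 3 → ℂ := fun k => thetaShift (μ k) (Q k) with hX
  set s : Fin 3 → ℂ := fun i => ∑ k, X k i with hs
  have hsS : ∀ i, s i = shiftSum t.1 Q i := sum_thetaShift ht Q
  have hmod : ∀ i, (shiftSum t.1 (reflectIndex t.1 Q) i : ZMod 2) = shiftSum t.1 Q i := fun i => by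
    rw [shiftSum_reflectIndex]
    push_cast
    rw [show (4 : ZMod 2) = 0 from rfl, zero_mul, sub_zero]
  simp only [hmod]
  set v : Fin 3 → ZMod 2 := fun i => (shiftSum t.1 Q i : ZMod 2) with hv
  have hval : ∀ i, ((v i).val : ℤ) = 2 * ((shiftSum t.1 Q i + 1) / 2) - shiftSum t.1 Q i :=
    fun i => by
      have : ((v i).val : ℤ) = shiftSum t.1 Q i % 2 := ZMod.val_intCast _
      omega
  have hshift : ∀ k i, thetaShift (μ k + charLift (v, 0)) (reflectIndex t.1 Q k) i =
      X k i - s i / 2 := fun k i => by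
    have h : (((v i).val : ℤ) : ℂ) =
        2 * (((shiftSum t.1 Q i + 1) / 2 : ℤ) : ℂ) - shiftSum t.1 Q i := by
      rw [hval]
      push_cast
      ring
    rw [hsS]
    simp only [hX, thetaShift, reflectIndex, charLift, Prod.fst_add, Pi.add_apply]
    push_cast at h ⊢
    rw [h]
    ring
  have hsecond : ∀ k i, (μ k + charLift (v, 0)).2 i = (μ k).2 i := fun k i => by
    simp [charLift]
  have ht2 : ∀ i, ∑ k, ((μ k).2 i : ℂ) = 2 * t.2 i := fun i => by
    have h : ∑ k, (μ k).2 i = 2 * t.2 i := by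
      simpa [Prod.snd_sum] using congrFun (congrArg Prod.snd ht) i
    exact_mod_cast h
  have hquad : ∑ k, ∑ i, ∑ j, (X k i - s i / 2) * τ i j * (X k j - s j / 2) =
      ∑ k, ∑ i, ∑ j, X k i * τ i j * X k j := by
    rw [Finset.sum_comm]
    conv_rhs => rw [Finset.sum_comm]
    refine Finset.sum_congr rfl fun i _ => ?_
    rw [Finset.sum_comm]
    conv_rhs => rw [Finset.sum_comm]
    refine Finset.sum_congr rfl fun j _ => ?_
    simp only [hs, Fin.sum_univ_four]
    ring
  have hlin : ∑ k, ∑ i, (X k i - s i / 2) * ((μ k).2 i : ℂ) =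
      ∑ k, ∑ i, X k i * ((μ k).2 i : ℂ) - ∑ i, s i * t.2 i := by
    rw [Finset.sum_comm, Finset.sum_comm (f := fun k i => X k i * ((μ k).2 i : ℂ)),
      ← Finset.sum_sub_distrib]
    refine Finset.sum_congr rfl fun i _ => ?_
    simp only [sub_mul, Finset.sum_sub_distrib, ← Finset.mul_sum, ht2]
    ring
  have hsign : (zmodSign (∑ i, v i * t.2 i) : ℂ) *
      Complex.exp (-(Real.pi * Complex.I * ∑ i, s i * t.2 i)) = 1 := by
    have h : ((∑ i, shiftSum t.1 Q i * t.2 i : ℤ) : ZMod 2) = ∑ i, v i * t.2 i := by simp [hv]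
    have h' : ∑ i, s i * t.2 i = ((∑ i, shiftSum t.1 Q i * t.2 i : ℤ) : ℂ) := by simp [hsS]
    rw [h', ← h, ← exp_pi_mul_I_mul_intCast, ← Complex.exp_add, add_neg_cancel, Complex.exp_zero]
  have hprod : (zmodSign (∑ i, v i * t.2 i) : ℂ) *
      ∏ k, thetaTerm (μ k + charLift (v, 0)) τ 0 (reflectIndex t.1 Q k) =
      ∏ k, thetaTerm (μ k) τ 0 (Q k) := by
    simp only [thetaTerm_eq_exp, ← Complex.exp_sum, ← Finset.mul_sum, hshift, hsecond,
      Finset.sum_add_distrib, hquad, hlin]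
    rw [← add_sub_assoc, mul_sub, sub_eq_add_neg, Complex.exp_add, mul_left_comm, hsign, mul_one]
  have hperm : ∀ l : Fin 4, ∏ k, thetaTerm ((μ ∘ Equiv.swap l 3) k) τ 0 ((Q ∘ Equiv.swap l 3) k) =
      ∏ k, thetaTerm (μ k) τ 0 (Q k) := fun l =>
    Equiv.prod_comp (Equiv.swap l 3) fun k => thetaTerm (μ k) τ 0 (Q k)
  have hdet : Matrix.det (Matrix.of fun i j : Fin 3 => X i.castSucc j - s j / 2) =
      -1 / 2 * ∑ l : Fin 4, Matrix.det (Matrix.of fun i j : Fin 3 =>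
        X (Equiv.swap l 3 i.castSucc) j) := by
    have e : ∀ l : Fin 4, (fun i : Fin 3 => X (Equiv.swap l 3 i.castSucc)) =
        ![![X 3, X 1, X 2], ![X 0, X 3, X 2], ![X 0, X 1, X 3], ![X 0, X 1, X 2]] l := by
      intro l
      funext i
      fin_cases l <;> fin_cases i <;> rfl
    have e' : ∀ l : Fin 4, (Matrix.of fun i j : Fin 3 => X (Equiv.swap l 3 i.castSucc) j) =
        Matrix.of (![![X 3, X 1, X 2], ![X 0, X 3, X 2], ![X 0, X 1, X 3], ![X 0, X 1, X 2]] l) :=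
      fun l => by rw [← e]
    simp only [e', Fin.sum_univ_four, Matrix.det_fin_three, hs]
    simp
    ring
  simp only [detTerm, hshift, hdet, hperm, ← Finset.sum_mul]
  rw [mul_left_comm, hprod, mul_assoc]
  rfl

/-- A Riemann relation for products of a Jacobian determinant and a theta constant. -/
theorem sum_zmodSign_mul_detTheta {τ : Matrix (Fin 3) (Fin 3) ℂ} (hτ : IsSiegel τ)
    {μ : Fin 4 → (Fin 3 → ℤ) × (Fin 3 → ℤ)} {t : (Fin 3 → ℤ) × (Fin 3 → ℤ)}
    (ht : ∑ k, μ k = 2 • t) :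
    ∑ ν : ThetaChar 3, (zmodSign (∑ i, ν.1 i * (t.2 i + ν.2 i)) : ℂ) *
        detTheta (fun k => μ k + charLift ν) τ =
      -4 * ∑ l : Fin 4, detTheta (μ ∘ Equiv.swap l 3) τ := by
  have h1 := hasSum_sum (s := Finset.univ) fun (ν : ThetaChar 3) _ =>
    (hasSum_detTerm hτ fun k => μ k + charLift ν).mul_left
      (zmodSign (∑ i, ν.1 i * (t.2 i + ν.2 i)) : ℂ)
  have h2 := (hasSum_sum (s := Finset.univ) fun (l : Fin 4) _ =>
    ((Equiv.arrowCongr (Equiv.swap l 3) (Equiv.refl (Fin 3 → ℤ))).hasSum_iff.mpr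
      (hasSum_detTerm hτ (μ ∘ Equiv.swap l 3)))).mul_left (-4)
  rw [← (reflectIndex_involutive t.1).toPerm.hasSum_iff] at h1
  refine h1.unique ?_
  convert h2 using 1
  funext Q
  have h3 : ∀ l : Fin 4, Equiv.arrowCongr (Equiv.swap l 3) (Equiv.refl (Fin 3 → ℤ)) Q =
      Q ∘ Equiv.swap l 3 := fun _ => rfl
  simp only [Function.comp_apply, Function.Involutive.coe_toPerm, h3, ← Finset.mul_sum,
    mul_left_comm _ ((2 * Real.pi * Complex.I) ^ 3 : ℂ), sum_zmodSign_mul_detTerm ht]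
  rw [mul_assoc (8 : ℂ), detTerm_reflectIndex ht]
  ring

/-! ### Relations with two terms -/

/-- The symplectic pairing on characteristics mod 2. -/
def charPair {g : ℕ} (m n : ThetaChar g) : ZMod 2 := ∑ i, (m.1 i * n.2 i + m.2 i * n.1 i)

lemma charQuad_add {g : ℕ} (m n : ThetaChar g) :
    charQuad (m + n) = charQuad m + charQuad n + charPair m n := by
  simp only [charQuad, charPair, ← Finset.sum_add_distrib]
  refine Finset.sum_congr rfl fun i _ => ?_
  simp only [Prod.fst_add, Prod.snd_add, Pi.add_apply]
  ring

lemma charPair_comm {g : ℕ} (m n : ThetaChar g) : charPair m n = charPair n m := by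
  refine Finset.sum_congr rfl fun i _ => ?_
  ring

lemma charPair_add_left {g : ℕ} (m n k : ThetaChar g) :
    charPair (m + n) k = charPair m k + charPair n k := by
  simp only [charPair, ← Finset.sum_add_distrib]
  refine Finset.sum_congr rfl fun i _ => ?_
  simp only [Prod.fst_add, Prod.snd_add, Pi.add_apply]
  ring

lemma charPair_add_right {g : ℕ} (m n k : ThetaChar g) :
    charPair m (n + k) = charPair m n + charPair m k := by
  rw [charPair_comm, charPair_add_left, charPair_comm n, charPair_comm k]

lemma charPair_self {g : ℕ} (m : ThetaChar g) : charPair m m = 0 := by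
  refine Finset.sum_eq_zero fun i _ => ?_
  rw [mul_comm (m.2 i)]
  exact CharTwo.add_self_eq_zero _

lemma thetaChar_add_self {g : ℕ} (m : ThetaChar g) : m + m = 0 :=
  Prod.ext (funext fun _ => CharTwo.add_self_eq_zero _)
    (funext fun _ => CharTwo.add_self_eq_zero _)

lemma detTheta_eq_zero_of_even {τ : Matrix (Fin 3) (Fin 3) ℂ} (hτ : IsSiegel τ)
    {μ : Fin 4 → (Fin 3 → ℤ) × (Fin 3 → ℤ)} {i : Fin 3}
    (h : charQuad (charRed (μ i.castSucc)) = 0) : detTheta μ τ = 0 := by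
  rw [detTheta, Matrix.det_eq_zero_of_row_eq_zero i, zero_mul]
  intro j
  simp [thetaGrad_eq_zero_of_even hτ h]

lemma detTheta_add_two_nsmul {τ : Matrix (Fin 3) (Fin 3) ℂ} (hτ : IsSiegel τ)
    (μ κ : Fin 4 → (Fin 3 → ℤ) × (Fin 3 → ℤ)) :
    detTheta (fun k => μ k + 2 • κ k) τ =
      zmodSign (∑ i, ∑ k, ((μ k).1 i : ZMod 2) * ((κ k).2 i : ZMod 2)) * detTheta μ τ := by
  rw [Finset.sum_comm, Fin.sum_univ_four]
  simp only [detTheta, Matrix.det_fin_three, Matrix.of_apply, thetaGrad_add_two_nsmul _ _ hτ,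
    theta_add_two_nsmul, zmodSign_add, show (0 : Fin 3).castSucc = 0 from rfl,
    show (1 : Fin 3).castSucc = 1 from rfl, show (2 : Fin 3).castSucc = 2 from rfl]
  push_cast
  ring

lemma detTheta_congr {τ : Matrix (Fin 3) (Fin 3) ℂ} (hτ : IsSiegel τ)
    {μ : Fin 4 → (Fin 3 → ℤ) × (Fin 3 → ℤ)} {t a b : (Fin 3 → ℤ) × (Fin 3 → ℤ)}
    (ht : ∑ k, μ k = 2 • t) (hab : charRed a = charRed b) :
    detTheta (fun k => μ k + a) τ = detTheta (fun k => μ k + b) τ := by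
  have h1 : ∀ i, ∃ c, a.1 i = b.1 i + 2 * c := fun i => by
    have := (ZMod.intCast_eq_intCast_iff_dvd_sub _ _ 2).mp (congrFun (congrArg Prod.fst hab) i).symm
    obtain ⟨c, hc⟩ := this
    exact ⟨c, by push_cast at hc; omega⟩
  have h2 : ∀ i, ∃ c, a.2 i = b.2 i + 2 * c := fun i => by
    have := (ZMod.intCast_eq_intCast_iff_dvd_sub _ _ 2).mp (congrFun (congrArg Prod.snd hab) i).symm
    obtain ⟨c, hc⟩ := this
    exact ⟨c, by push_cast at hc; omega⟩
  choose c hc using h1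
  choose c' hc' using h2
  have ha : a = b + 2 • (c, c') := by
    ext i
    · simpa using hc i
    · simpa using hc' i
  have hsum : ∀ i, ∑ k, ((((μ k + b).1 i : ℤ) : ZMod 2) * (c' i : ZMod 2)) = 0 := fun i => by
    have h : ∑ k, (μ k).1 i = 2 * t.1 i := by
      simpa [Prod.fst_sum] using congrFun (congrArg Prod.fst ht) i
    have h' : ∑ k, (((μ k + b).1 i : ℤ) : ZMod 2) = ((2 * t.1 i + 4 * b.1 i : ℤ) : ZMod 2) := by
      rw [← h]
      simp [Finset.sum_add_distrib]
    rw [← Finset.sum_mul, h']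
    push_cast
    rw [show (4 : ZMod 2) = 0 from rfl, show (2 : ZMod 2) = 0 from rfl]
    ring
  rw [ha]
  simp only [← add_assoc]
  rw [detTheta_add_two_nsmul hτ (fun k => μ k + b) (fun _ => (c, c')),
    Finset.sum_eq_zero fun i _ => hsum i]
  simp [zmodSign]

lemma sum_zmodSign_mul_detTheta_eq_zero {τ : Matrix (Fin 3) (Fin 3) ℂ} (hτ : IsSiegel τ)
    {μ : Fin 4 → (Fin 3 → ℤ) × (Fin 3 → ℤ)} {t : (Fin 3 → ℤ) × (Fin 3 → ℤ)}
    (ht : ∑ k, μ k = 2 • t) (n : ThetaChar 3)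
    (hn : ∀ i : Fin 3, charQuad (charRed (μ i.castSucc) + n) = 0) :
    ∑ ν : ThetaChar 3, (zmodSign (∑ i, (ν + n).1 i * (t.2 i + (ν + n).2 i)) : ℂ) *
        detTheta (fun k => μ k + charLift ν) τ = 0 := by
  have ht' : ∑ k, (μ k + charLift n) = 2 • (t + 2 • charLift n) := by
    rw [Finset.sum_add_distrib, ht]
    simp only [Finset.sum_const, Finset.card_univ, Fintype.card_fin]
    module
  have h := sum_zmodSign_mul_detTheta hτ ht'
  have hr : ∀ l : Fin 4, detTheta ((fun k => μ k + charLift n) ∘ Equiv.swap l 3) τ = 0 := by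
    intro l
    obtain ⟨i, j, hij⟩ : ∃ i j : Fin 3, Equiv.swap l 3 i.castSucc = j.castSucc := by
      revert l
      decide
    refine detTheta_eq_zero_of_even hτ (i := i) ?_
    simp only [Function.comp_apply, hij, charRed_add, charRed_charLift, hn]
  rw [Finset.sum_eq_zero fun l _ => hr l, mul_zero] at h
  refine Eq.trans ?_ h
  rw [← Equiv.sum_comp (Equiv.addRight n)]
  refine Finset.sum_congr rfl fun ν _ => ?_
  have h1 : ν + n + n = ν := by rw [add_assoc, thetaChar_add_self, add_zero]
  have h2 : ∀ i, (((t + 2 • charLift n).2 i : ℤ) : ZMod 2) = t.2 i := fun i => by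
    simp [show (2 : ZMod 2) = 0 from rfl]
  have h3 : detTheta (fun k => μ k + charLift (ν + n)) τ =
      detTheta (fun k => μ k + (charLift n + charLift ν)) τ :=
    detTheta_congr hτ ht (by simp only [charRed_add, charRed_charLift, add_comm])
  simp only [Equiv.coe_addRight, h1, h2, h3, add_assoc]

lemma detTheta_two_term {τ : Matrix (Fin 3) (Fin 3) ℂ} (hτ : IsSiegel τ)
    {μ : Fin 4 → (Fin 3 → ℤ) × (Fin 3 → ℤ)} {t : (Fin 3 → ℤ) × (Fin 3 → ℤ)}
    (ht : ∑ k, μ k = 2 • t) {n d : ThetaChar 3} (hd : d ≠ 0) (hnd : charPair n d = 0)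
    (hn : ∀ i : Fin 3, charQuad (charRed (μ i.castSucc) + n) = 0)
    (hn' : ∀ i : Fin 3, charQuad (charRed (μ i.castSucc) + (n + d)) = 0)
    (huniq : ∀ z, (∀ i : Fin 3, charQuad (charRed (μ i.castSucc) + z) = 1) →
      charPair z d = 0 → z = 0 ∨ z = d) :
    detTheta (fun k => μ k + charLift d) τ =
      -zmodSign (charQuad d + ∑ i, d.1 i * t.2 i) * detTheta μ τ := by
  set ε : ThetaChar 3 → ZMod 2 := fun a => ∑ i, a.1 i * (t.2 i + a.2 i) with hε
  have hεd : ε d = charQuad d + ∑ i, d.1 i * t.2 i := by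
    simp only [hε, charQuad, mul_add, Finset.sum_add_distrib]
    ring
  have hadd : ∀ ν, ε (ν + (n + d)) = ε (ν + n) + ε d + charPair ν d := fun ν => by
    rw [← add_zero (charPair ν d), ← hnd, ← charPair_add_left]
    simp only [hε, charPair, ← Finset.sum_add_distrib]
    refine Finset.sum_congr rfl fun i _ => ?_
    simp only [Prod.fst_add, Prod.snd_add, Pi.add_apply]
    ring
  have h1 := sum_zmodSign_mul_detTheta_eq_zero hτ ht n hn
  have h2 := sum_zmodSign_mul_detTheta_eq_zero hτ ht (n + d) hn'
  set F : ThetaChar 3 → ℂ := fun ν => detTheta (fun k => μ k + charLift ν) τ with hF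
  have h3 : ∑ ν, ((zmodSign (ε (ν + n)) : ℂ) + zmodSign (ε d) * zmodSign (ε (ν + (n + d)))) * F ν
      = 0 := by
    simp only [add_mul, Finset.sum_add_distrib, mul_assoc, ← Finset.mul_sum]
    rw [h1, h2, mul_zero, add_zero]
  have h4 : ∀ ν, ((zmodSign (ε (ν + n)) : ℂ) + zmodSign (ε d) * zmodSign (ε (ν + (n + d)))) =
      zmodSign (ε (ν + n)) * (1 + zmodSign (charPair ν d)) := fun ν => by
    have : (zmodSign (ε d) * zmodSign (ε d) : ℂ) = 1 := by exact_mod_cast zmodSign_mul_self _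
    rw [hadd, zmodSign_add, zmodSign_add]
    push_cast
    linear_combination zmodSign (ε (ν + n)) * zmodSign (charPair ν d) * this
  have hbit : ∀ a : ZMod 2, a = 0 ∨ a = 1 := by decide
  have h5 : ∀ ν, ν ≠ 0 ∧ ν ≠ d →
      ((zmodSign (ε (ν + n)) : ℂ) + zmodSign (ε d) * zmodSign (ε (ν + (n + d)))) * F ν = 0 := by
    rintro ν ⟨hν0, hνd⟩
    rw [h4]
    rcases hbit (charPair ν d) with h | h
    · have : ∃ i : Fin 3, charQuad (charRed (μ i.castSucc) + ν) = 0 := by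
        by_contra! hc
        exact (huniq ν (fun i => (hbit _).resolve_left (hc i)) h).elim hν0 hνd
      obtain ⟨i, hi⟩ := this
      have : F ν = 0 := detTheta_eq_zero_of_even hτ (i := i) (by
        rwa [charRed_add, charRed_charLift])
      rw [this, mul_zero]
    · rw [h]
      simp [zmodSign, ZMod.val_one]
  rw [Fintype.sum_eq_add 0 d hd.symm h5, h4, h4, zero_add, show d + n = 0 + (n + d) by abel, hadd,
    zero_add] at h3
  have hz : charPair 0 d = 0 := by simp [charPair]
  have hF0 : F 0 = detTheta μ τ := by
    simp only [hF]
    congr 1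
    funext k
    ext i <;> simp [charLift]
  rw [charPair_self, hz, add_zero, zmodSign_add, hF0] at h3
  have hs : (zmodSign (ε n) * zmodSign (ε n) : ℂ) = 1 := by exact_mod_cast zmodSign_mul_self _
  have hs' : (zmodSign (ε d) * zmodSign (ε d) : ℂ) = 1 := by exact_mod_cast zmodSign_mul_self _
  rw [← hεd]
  simp only [show zmodSign 0 = 1 from rfl] at h3
  push_cast at h3
  change F d = _
  linear_combination (zmodSign (ε n) * zmodSign (ε d) / 2) * h3 -
    (zmodSign (ε d) * detTheta μ τ + zmodSign (ε d) * zmodSign (ε d) * F d) * hs - F d * hs'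

/-- The exponent of the sign in the relation between the values of `detTheta` at a quadruple of
characteristics and at its translate by `d`. -/
def translateSign (x : Fin 4 → ThetaChar 3) (d : ThetaChar 3) : ZMod 2 :=
  charQuad d + ∑ i, (d.1 i * (((∑ k, ((x k).2 i).val) / 2 : ℕ) : ZMod 2) +
    d.2 i * ∑ k, (x k).1 i * (x k).2 i)

lemma detTheta_charLift_add {τ : Matrix (Fin 3) (Fin 3) ℂ} (hτ : IsSiegel τ)
    {x : Fin 4 → ThetaChar 3} (hx : ∑ k, x k = 0) {n d : ThetaChar 3} (hd : d ≠ 0)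
    (hnd : charPair n d = 0) (hn : ∀ i : Fin 3, charQuad (x i.castSucc + n) = 0)
    (hn' : ∀ i : Fin 3, charQuad (x i.castSucc + (n + d)) = 0)
    (huniq : ∀ z, (∀ i : Fin 3, charQuad (x i.castSucc + z) = 1) →
      charPair z d = 0 → z = 0 ∨ z = d) :
    detTheta (fun k => charLift (x k + d)) τ =
      -zmodSign (translateSign x d) * detTheta (fun k => charLift (x k)) τ := by
  set t : (Fin 3 → ℤ) × (Fin 3 → ℤ) :=
    (fun i => ((∑ k, ((x k).1 i).val) / 2 : ℕ), fun i => ((∑ k, ((x k).2 i).val) / 2 : ℕ)) with ht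
  have hx1 : ∀ i, ∑ k, (x k).1 i = 0 := fun i => by
    simpa [Prod.fst_sum] using congrFun (congrArg Prod.fst hx) i
  have hx2 : ∀ i, ∑ k, (x k).2 i = 0 := fun i => by
    simpa [Prod.snd_sum] using congrFun (congrArg Prod.snd hx) i
  have heven : ∀ a : Fin 4 → ZMod 2, ∑ k, a k = 0 →
      ∑ k, ((a k).val : ℤ) = 2 * (((∑ k, (a k).val) / 2 : ℕ) : ℤ) := fun a ha => by
    have h : 2 ∣ ∑ k, (a k).val := by
      rw [← ZMod.natCast_eq_zero_iff]
      simpa using ha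
    rw [← Nat.cast_sum]
    omega
  have hsum : ∑ k, charLift (x k) = 2 • t := by
    ext i
    · rw [Prod.fst_sum, Finset.sum_apply]
      exact (heven _ (hx1 i)).trans ((two_mul _).trans (two_nsmul _).symm)
    · rw [Prod.snd_sum, Finset.sum_apply]
      exact (heven _ (hx2 i)).trans ((two_mul _).trans (two_nsmul _).symm)
  have h1 := detTheta_two_term hτ hsum hd hnd (by simpa only [charRed_charLift] using hn)
    (by simpa only [charRed_charLift] using hn') (by simpa only [charRed_charLift] using huniq)
  have hcarry : ∀ a b : ZMod 2, (a.val : ℤ) + b.val = (a + b).val + 2 * (a.val * b.val) := by decide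
  have hlift : ∀ k, charLift (x k) + charLift d = charLift (x k + d) + 2 •
      ((fun i => ((x k).1 i).val * (d.1 i).val, fun i => ((x k).2 i).val * (d.2 i).val) :
        (Fin 3 → ℤ) × (Fin 3 → ℤ)) := fun k => by
    ext i
    · simpa [charLift] using hcarry ((x k).1 i) (d.1 i)
    · simpa [charLift] using hcarry ((x k).2 i) (d.2 i)
  simp only [hlift] at h1
  rw [detTheta_add_two_nsmul hτ (fun k => charLift (x k + d))] at h1
  have h2 : ∀ i, ∑ k, (((charLift (x k + d)).1 i : ℤ) : ZMod 2) *
      ((((x k).2 i).val * (d.2 i).val : ℤ) : ZMod 2) = d.2 i * ∑ k, (x k).1 i * (x k).2 i :=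
    fun i => by
      have h3 : ∀ k, (((charLift (x k + d)).1 i : ℤ) : ZMod 2) *
          ((((x k).2 i).val * (d.2 i).val : ℤ) : ZMod 2) =
          d.2 i * ((x k).1 i * (x k).2 i) + d.1 i * d.2 i * (x k).2 i := fun k => by
        simp [charLift]
        ring
      simp only [h3, Finset.sum_add_distrib, ← Finset.mul_sum, hx2, mul_zero, add_zero]
  simp only [h2] at h1
  have h4 : ∀ i, ((t.2 i : ℤ) : ZMod 2) = (((∑ k, ((x k).2 i).val) / 2 : ℕ) : ZMod 2) :=
    fun i => by rw [ht, Int.cast_natCast]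
  have h5 : translateSign x d = ∑ i, d.2 i * ∑ k, (x k).1 i * (x k).2 i +
      (charQuad d + ∑ i, d.1 i * t.2 i) := by
    simp only [translateSign, h4, Finset.sum_add_distrib]
    ring
  set A : ℂ := (zmodSign (∑ i, d.2 i * ∑ k, (x k).1 i * (x k).2 i) : ℂ) with hA
  have hs : A * A = 1 := by
    rw [hA]
    exact_mod_cast zmodSign_mul_self _
  rw [h5, zmodSign_add]
  push_cast
  linear_combination A * h1 - detTheta (fun k => charLift (x k + d)) τ * hs

lemma D3_mul_theta (a b c m : ThetaChar 3) (τ : Matrix (Fin 3) (Fin 3) ℂ) :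
    theta (charLift m) τ 0 * D3 a b c τ =
      ((Real.pi : ℂ) ^ 3)⁻¹ * detTheta (fun k => charLift (![a, b, c, m] k)) τ := by
  have h : (Matrix.of fun i j : Fin 3 => thetaGrad (![charLift a, charLift b, charLift c] i) τ j) =
      Matrix.of fun i j : Fin 3 => thetaGrad (charLift (![a, b, c, m] i.castSucc)) τ j := by
    ext i j
    fin_cases i <;> rfl
  rw [D3, jacDet, detTheta, h]
  simp only [show ![a, b, c, m] 3 = m from rfl]
  ring

lemma translateSign_sum (x y z d : ThetaChar 3) :
    translateSign ![x, y, z, x + y + z] d + translateSign ![x, z + d, y + d, x + y + z] d +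
      translateSign ![z + d, y, x + d, x + y + z] d +
      translateSign ![y + d, x + d, z, x + y + z] d = charQuad d := by
  have key : ∀ a b x x' y y' z z' : ZMod 2,
      (a * (((x'.val + y'.val + z'.val + (x' + y' + z').val) / 2 : ℕ) : ZMod 2) +
        b * (x * x' + y * y' + z * z' + (x + y + z) * (x' + y' + z'))) +
      (a * (((x'.val + (z' + b).val + (y' + b).val + (x' + y' + z').val) / 2 : ℕ) : ZMod 2) +
        b * (x * x' + (z + a) * (z' + b) + (y + a) * (y' + b) + (x + y + z) * (x' + y' + z'))) +
      (a * ((((z' + b).val + y'.val + (x' + b).val + (x' + y' + z').val) / 2 : ℕ) : ZMod 2) +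
        b * ((z + a) * (z' + b) + y * y' + (x + a) * (x' + b) + (x + y + z) * (x' + y' + z'))) +
      (a * ((((y' + b).val + (x' + b).val + z'.val + (x' + y' + z').val) / 2 : ℕ) : ZMod 2) +
        b * ((y + a) * (y' + b) + (x + a) * (x' + b) + z * z' + (x + y + z) * (x' + y' + z'))) =
      a * b := by
    decide
  have hq : charQuad d = ∑ i, d.1 i * d.2 i := rfl
  have h4 : 4 * charQuad d = 0 := by rw [show (4 : ZMod 2) = 0 from rfl, zero_mul]
  have := Finset.sum_congr (rfl : (Finset.univ : Finset (Fin 3)) = Finset.univ) fun i _ =>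
    key (d.1 i) (d.2 i) (x.1 i) (x.2 i) (y.1 i) (y.2 i) (z.1 i) (z.2 i)
  simp only [Finset.sum_add_distrib] at this
  simp only [translateSign, Fin.sum_univ_four, Matrix.cons_val, Prod.fst_add, Prod.snd_add,
    Pi.add_apply, Finset.sum_add_distrib]
  linear_combination this + h4 - hq

/-! ### Aronhold sets -/

lemma charQuad_eq_one_of_isOddChar {g : ℕ} {m : ThetaChar g} (h : IsOddChar m) :
    charQuad m = 1 := by
  rw [IsOddChar, charParity_eq] at h
  revert h
  generalize charQuad m = a
  revert a
  decide

lemma IsAronhold.charQuad_eq_one {n : Fin 7 → ThetaChar 3} (hA : IsAronhold n) (i : Fin 7) :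
    charQuad (n i) = 1 :=
  charQuad_eq_one_of_isOddChar (hA.2.1 i)

lemma IsAronhold.charQuad_triple_of_lt {n : Fin 7 → ThetaChar 3} (hA : IsAronhold n)
    {i j k : Fin 7} (hij : i < j) (hjk : j < k) : charQuad (n i + n j + n k) = 0 := by
  have h := hA.2.2 i.castSucc j.castSucc k.castSucc hij hjk
  simp only [Fin.snoc_castSucc, charParity_eq, hA.charQuad_eq_one] at h
  revert h
  generalize charQuad (n i + n j + n k) = a
  revert a
  decide

lemma IsAronhold.charQuad_triple {n : Fin 7 → ThetaChar 3} (hA : IsAronhold n)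
    {i j k : Fin 7} (hij : i ≠ j) (hik : i ≠ k) (hjk : j ≠ k) :
    charQuad (n i + n j + n k) = 0 := by
  have h := @IsAronhold.charQuad_triple_of_lt n hA
  rcases hij.lt_or_gt with h1 | h1 <;> rcases hik.lt_or_gt with h2 | h2 <;>
    rcases hjk.lt_or_gt with h3 | h3
  · exact h h1 h3
  · rw [add_right_comm]
    exact h h2 h3
  · exact absurd (h1.trans h3) h2.asymm
  · rw [add_right_comm, add_comm (n i)]
    exact h h2 h1
  · rw [add_comm (n i)]
    exact h h1 h2
  · exact absurd (h2.trans h3) h1.asymm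
  · rw [add_comm (n i), add_right_comm]
    exact h h3 h2
  · rw [add_comm (n i), add_right_comm, add_comm (n j)]
    exact h h3 h1

lemma IsAronhold.charPair_triple {n : Fin 7 → ThetaChar 3} (hA : IsAronhold n)
    {i j k : Fin 7} (hij : i ≠ j) (hik : i ≠ k) (hjk : j ≠ k) :
    charPair (n i) (n j) + charPair (n i) (n k) + charPair (n j) (n k) = 1 := by
  have h := hA.charQuad_triple hij hik hjk
  rw [charQuad_add, charQuad_add, charPair_add_left, hA.charQuad_eq_one, hA.charQuad_eq_one,
    hA.charQuad_eq_one] at h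
  linear_combination h - 2 * CharTwo.two_eq_zero (R := ZMod 2)

/-- A characteristic that pairs equally with all members of an Aronhold set vanishes. -/
lemma IsAronhold.eq_zero_of_charPair {n : Fin 7 → ThetaChar 3} (hA : IsAronhold n)
    {y : ThetaChar 3} {c : ZMod 2} (hy : ∀ i, charPair y (n i) = c) : y = 0 := by
  set b : Fin 6 → ThetaChar 3 := fun i => n i.castSucc + n 6 with hb
  have hne : ∀ i : Fin 6, (i.castSucc : Fin 7) ≠ 6 := by decide
  have hyb : ∀ i, charPair y (b i) = 0 := fun i => by
    rw [charPair_add_right, hy, hy]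
    exact CharTwo.add_self_eq_zero c
  have hbb : ∀ i j, charPair (b i) (b j) = if i = j then 0 else 1 := fun i j => by
    split_ifs with h
    · rw [h, charPair_self]
    · have := hA.charPair_triple (fun h' => h (Fin.castSucc_injective _ h')) (hne i) (hne j)
      simp only [hb, charPair_add_left, charPair_add_right, charPair_self, add_zero]
      rw [← this, charPair_comm (n 6)]
      ring
  have hsmul : ∀ (a : ZMod 2) (m k : ThetaChar 3), charPair (a • m) k = a * charPair m k :=
    fun a m k => by
      simp only [charPair, Finset.mul_sum]
      refine Finset.sum_congr rfl fun i _ => ?_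
      simp only [Prod.smul_fst, Prod.smul_snd, Pi.smul_apply, smul_eq_mul]
      ring
  set φ : (Fin 6 → ZMod 2) → ThetaChar 3 := fun a => ∑ i, a i • b i with hφ
  have hφb : ∀ a j, charPair (φ a) (b j) = ∑ i, a i * (if i = j then 0 else 1) := fun a j => by
    simp only [hφ, Fin.sum_univ_six, charPair_add_left, hsmul, hbb]
  have hgram : ∀ a : Fin 6 → ZMod 2, (∀ j, ∑ i, a i * (if i = j then 0 else 1) = 0) → a = 0 := by
    decide
  have hinj : Function.Injective φ := fun a a' h => by
    rw [← sub_eq_zero]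
    refine hgram _ fun j => ?_
    simp only [Pi.sub_apply, sub_mul, Finset.sum_sub_distrib, ← hφb, h, sub_self]
  have hcard : Fintype.card (Fin 6 → ZMod 2) = Fintype.card (ThetaChar 3) := by
    simp [ThetaChar, ZMod.card]
  obtain ⟨a, ha⟩ := ((Fintype.bijective_iff_injective_and_card φ).mpr ⟨hinj, hcard⟩).2 y
  have h0 : a = 0 := hgram a fun j => by rw [← hφb, ha, hyb]
  rw [← ha, h0]
  simp [hφ]

lemma IsAronhold.charQuad_add_complement {n : Fin 7 → ThetaChar 3} (hA : IsAronhold n)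
    {i : Fin 7} (h3 : i ≠ 3) (h4 : i ≠ 4) (h5 : i ≠ 5) (h6 : i ≠ 6) :
    charQuad (n i + (n 3 + n 4 + n 5 + n 6)) = 1 := by
  have t1 := hA.charPair_triple h3 h4 (by decide)
  have t2 := hA.charPair_triple h5 h6 (by decide)
  have t3 := hA.charPair_triple (i := 3) (j := 5) (k := 6) (by decide) (by decide) (by decide)
  have t4 := hA.charPair_triple (i := 4) (j := 5) (k := 6) (by decide) (by decide) (by decide)
  simp only [charQuad_add, charPair_add_left, charPair_add_right, hA.charQuad_eq_one]
  linear_combination t1 + t2 + t3 + t4 +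
    (4 - charPair (n 5) (n 6)) * CharTwo.two_eq_zero (R := ZMod 2)

/-- Translates of the first three members of an Aronhold set are odd only for the zero
characteristic and the sum of the last four members. -/
lemma IsAronhold.eq_zero_or_eq_complement {n : Fin 7 → ThetaChar 3} (hA : IsAronhold n)
    {z : ThetaChar 3} (h0 : charQuad (n 0 + z) = 1) (h1 : charQuad (n 1 + z) = 1)
    (h2 : charQuad (n 2 + z) = 1) (hz : charPair z (n 3 + n 4 + n 5 + n 6) = 0) :
    z = 0 ∨ z = n 3 + n 4 + n 5 + n 6 := by
  have htwo : (2 : ZMod 2) = 0 := rfl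
  have hbit : ∀ a : ZMod 2, a = 0 ∨ a = 1 := by decide
  set c := charQuad z with hc
  have hfirst : ∀ i, charQuad (n i + z) = 1 → charPair z (n i) = c := fun i hi => by
    rw [charQuad_add, hA.charQuad_eq_one, charPair_comm] at hi
    linear_combination hi - c * htwo
  have hpair : ∀ a b : Fin 7, a ≠ b → 0 ≠ a → 0 ≠ b →
      ¬ ∀ i, charPair z (n i) = c + if i = a ∨ i = b then 1 else 0 := by
    intro a b hab ha hb h
    have hzab : z + (n a + n b) = 0 := by
      refine hA.eq_zero_of_charPair (c := c + charPair (n a) (n b) + 1) fun i => ?_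
      rw [charPair_add_left, charPair_add_left, h]
      rcases eq_or_ne i a with rfl | hia
      · simp only [true_or, if_true, charPair_self, charPair_comm (n b)]
        ring
      rcases eq_or_ne i b with rfl | hib
      · simp only [or_true, if_true, charPair_self]
        ring
      · have := hA.charPair_triple hab hia.symm hib.symm
        simp only [hia, hib, or_self, if_false]
        linear_combination this - charPair (n a) (n b) * htwo
    have hz' : z = n a + n b := by
      rw [← add_zero z, ← thetaChar_add_self (n a + n b), ← add_assoc, hzab, zero_add]
    rw [hz', ← add_assoc, hA.charQuad_triple ha hb hab] at h0
    exact zero_ne_one h0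
  have e0 := hfirst 0 h0
  have e1 := hfirst 1 h1
  have e2 := hfirst 2 h2
  simp only [charPair_add_right] at hz
  have hval : ∀ i, charPair z (n i) = c ∨ charPair z (n i) = c + 1 := fun i => by
    rcases hbit (charPair z (n i) - c) with h | h
    · exact Or.inl (by linear_combination h)
    · exact Or.inr (by linear_combination h)
  rcases hval 3 with e3 | e3 <;> rcases hval 4 with e4 | e4 <;> rcases hval 5 with e5 | e5 <;>
    rcases hval 6 with e6 | e6
  case inr.inr.inr.inr =>
    right
    have hsum : z + (n 3 + n 4 + n 5 + n 6) = 0 := by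
      refine hA.eq_zero_of_charPair
        (c := c + charPair (n 3) (n 4) + charPair (n 5) (n 6)) fun i => ?_
      simp only [charPair_add_left]
      by_cases hi : i = 3 ∨ i = 4 ∨ i = 5 ∨ i = 6
      · have t := @IsAronhold.charPair_triple n hA
        rcases hi with rfl | rfl | rfl | rfl
        · have := t (i := 3) (j := 5) (k := 6) (by decide) (by decide) (by decide)
          rw [e3, charPair_self, charPair_comm (n 4), charPair_comm (n 5) (n 3),
            charPair_comm (n 6)]
          linear_combination this + (1 - charPair (n 5) (n 6)) * htwo
        · have := t (i := 4) (j := 5) (k := 6) (by decide) (by decide) (by decide)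
          rw [e4, charPair_self, charPair_comm (n 5) (n 4), charPair_comm (n 6)]
          linear_combination this + (1 - charPair (n 5) (n 6)) * htwo
        · have := t (i := 3) (j := 4) (k := 5) (by decide) (by decide) (by decide)
          rw [e5, charPair_self, charPair_comm (n 6)]
          linear_combination this + (1 - charPair (n 3) (n 4)) * htwo
        · have := t (i := 3) (j := 4) (k := 6) (by decide) (by decide) (by decide)
          rw [e6, charPair_self]
          linear_combination this + (1 - charPair (n 3) (n 4)) * htwo
      · simp only [not_or] at hi
        have t1 := hA.charPair_triple hi.1 hi.2.1 (by decide)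
        have t2 := hA.charPair_triple hi.2.2.1 hi.2.2.2 (by decide)
        have hzi : charPair z (n i) = c := by
          revert hi
          fin_cases i <;> simp [e0, e1, e2]
        rw [hzi, charPair_comm _ (n i), charPair_comm _ (n i), charPair_comm _ (n i),
          charPair_comm _ (n i)]
        linear_combination t1 + t2 + (1 - charPair (n 3) (n 4) - charPair (n 5) (n 6)) * htwo
    rw [← add_zero z, ← thetaChar_add_self (n 3 + n 4 + n 5 + n 6), ← add_assoc, hsum, zero_add]
  case inl.inl.inl.inl =>
    left
    refine hA.eq_zero_of_charPair (c := c) fun i => ?_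
    fin_cases i <;> assumption
  all_goals first
    | exact absurd (show (1 : ZMod 2) = 0 by
        linear_combination hz - e3 - e4 - e5 - e6 - 2 * c * htwo) one_ne_zero
    | exact absurd (show (1 : ZMod 2) = 0 by
        linear_combination hz - e3 - e4 - e5 - e6 - (2 * c + 1) * htwo) one_ne_zero
    | refine absurd (fun i => ?_) (hpair 3 4 (by decide) (by decide) (by decide))
      fin_cases i <;> simp [*]
      done
    | refine absurd (fun i => ?_) (hpair 3 5 (by decide) (by decide) (by decide))
      fin_cases i <;> simp [*]
      done
    | refine absurd (fun i => ?_) (hpair 3 6 (by decide) (by decide) (by decide))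
      fin_cases i <;> simp [*]
      done
    | refine absurd (fun i => ?_) (hpair 4 5 (by decide) (by decide) (by decide))
      fin_cases i <;> simp [*]
      done
    | refine absurd (fun i => ?_) (hpair 4 6 (by decide) (by decide) (by decide))
      fin_cases i <;> simp [*]
      done
    | refine absurd (fun i => ?_) (hpair 5 6 (by decide) (by decide) (by decide))
      fin_cases i <;> simp [*]

/-- The relation of `detTheta_charLift_add` for a quadruple whose first three members are, up to
translation by the complementary sum, the first three members of an Aronhold set. -/
lemma IsAronhold.detTheta_charLift_add {n : Fin 7 → ThetaChar 3} (hA : IsAronhold n)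
    {τ : Matrix (Fin 3) (Fin 3) ℂ} (hτ : IsSiegel τ) {d : ThetaChar 3}
    (hd : d = n 3 + n 4 + n 5 + n 6) (hd0 : d ≠ 0) {x : Fin 4 → ThetaChar 3}
    (hx : ∑ k, x k = 0)
    (hxn : ∀ i : Fin 3, ∃ j : Fin 3, x j.castSucc = n (i.castLE (by decide)) ∨
      x j.castSucc = n (i.castLE (by decide)) + d)
    (hxn' : ∀ j : Fin 3, ∃ i : Fin 3, x j.castSucc = n (i.castLE (by decide)) ∨
      x j.castSucc = n (i.castLE (by decide)) + d) :
    detTheta (fun k => charLift (x k + d)) τ =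
      -zmodSign (translateSign x d) * detTheta (fun k => charLift (x k)) τ := by
  have hne : ∀ i : Fin 3, (i.castLE (by decide) : Fin 7) ≠ 3 ∧
      (i.castLE (by decide) : Fin 7) ≠ 4 ∧ (i.castLE (by decide) : Fin 7) ≠ 5 ∧
      (i.castLE (by decide) : Fin 7) ≠ 6 := by decide
  have hdd : n 5 + n 6 + d = n 3 + n 4 := by
    rw [hd, show n 5 + n 6 + (n 3 + n 4 + n 5 + n 6) = n 3 + n 4 + ((n 5 + n 6) + (n 5 + n 6)) by
      abel, thetaChar_add_self, add_zero]
  have hdd' : d + (n 5 + n 6) = n 3 + n 4 := by rw [add_comm, hdd]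
  have hdd'' : d + (n 3 + n 4) = n 5 + n 6 := by
    rw [← hdd', ← add_assoc, thetaChar_add_self, zero_add]
  have hq : ∀ i : Fin 3, charQuad d = charPair (n (i.castLE (by decide))) d := fun i => by
    obtain ⟨h3, h4, h5, h6⟩ := hne i
    have h := hA.charQuad_add_complement h3 h4 h5 h6
    rw [← hd, charQuad_add, hA.charQuad_eq_one] at h
    linear_combination h - charPair (n (i.castLE (by decide))) d * CharTwo.two_eq_zero (R := ZMod 2)
  have heven : ∀ i : Fin 3, charQuad (n (i.castLE (by decide)) + (n 5 + n 6)) = 0 ∧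
      charQuad (n (i.castLE (by decide)) + (n 3 + n 4)) = 0 := fun i => by
    obtain ⟨h3, h4, h5, h6⟩ := hne i
    rw [← add_assoc, ← add_assoc]
    exact ⟨hA.charQuad_triple h5 h6 (by decide), hA.charQuad_triple h3 h4 (by decide)⟩
  refine _root_.detTheta_charLift_add hτ hx (n := n 5 + n 6) hd0 ?_ ?_ ?_ ?_
  · have t1 := hA.charPair_triple (i := 3) (j := 5) (k := 6) (by decide) (by decide) (by decide)
    have t2 := hA.charPair_triple (i := 4) (j := 5) (k := 6) (by decide) (by decide) (by decide)
    rw [hd]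
    simp only [charPair_add_left, charPair_add_right, charPair_self, charPair_comm (n 5) (n 3),
      charPair_comm (n 5) (n 4), charPair_comm (n 6)]
    linear_combination t1 + t2 + CharTwo.two_eq_zero (R := ZMod 2)
  · intro j
    obtain ⟨i, hi | hi⟩ := hxn' j
    · rw [hi, (heven i).1]
    · rw [hi, add_assoc, hdd', (heven i).2]
  · intro j
    obtain ⟨i, hi | hi⟩ := hxn' j
    · rw [hi, hdd, (heven i).2]
    · rw [hi, hdd, add_assoc, hdd'', (heven i).1]
  · intro z hz hzd
    have hz' : ∀ i : Fin 3, charQuad (n (i.castLE (by decide)) + z) = 1 := fun i => by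
      obtain ⟨j, hj | hj⟩ := hxn i
      · rw [← hj, hz]
      · have h := hz j
        rw [hj, add_right_comm, charQuad_add, charPair_add_left, hzd, ← hq i] at h
        linear_combination h - charQuad d * CharTwo.two_eq_zero (R := ZMod 2)
    rw [hd] at hzd ⊢
    exact hA.eq_zero_or_eq_complement (hz' 0) (hz' 1) (hz' 2) hzd

/-- Weber's formula, in genus 3, written without denominators. -/
theorem weber_formula (n : Fin 7 → ThetaChar 3) (hA : IsAronhold n)
    (m₁ m₂ : ThetaChar 3) (hm₁ : m₁ = ∑ i, n i) (hm₂ : m₂ = n 0 + n 1 + n 2)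
    (hne : m₁ ≠ m₂)
    (τ : Matrix (Fin 3) (Fin 3) ℂ) (hτ : IsSiegel τ)
    (hev : ∀ m : ThetaChar 3, IsEvenChar m → theta (charLift m) τ 0 ≠ 0) :
    theta (charLift m₁) τ 0 ^ 4 *
      (D3 (m₁ + n 1 + n 2) (m₁ + n 0 + n 2) (m₁ + n 0 + n 1) τ *
       D3 (m₁ + n 1 + n 2) (n 2) (n 1) τ *
       D3 (n 2) (m₁ + n 0 + n 2) (n 0) τ *
       D3 (n 1) (n 0) (m₁ + n 0 + n 1) τ) =
    (charParity (m₁ + m₂) : ℂ) * theta (charLift m₂) τ 0 ^ 4 *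
      (D3 (n 0) (n 1) (n 2) τ *
       D3 (n 0) (m₁ + n 0 + n 1) (m₁ + n 0 + n 2) τ *
       D3 (m₁ + n 0 + n 1) (n 1) (m₁ + n 1 + n 2) τ *
       D3 (m₁ + n 0 + n 2) (m₁ + n 1 + n 2) (n 2) τ) := by
  set d := n 3 + n 4 + n 5 + n 6 with hd
  have hm : m₁ = m₂ + d := by
    rw [hm₁, hm₂, Fin.sum_univ_seven, hd]
    abel
  have hmd : m₁ + m₂ = d := by
    rw [hm, add_right_comm, thetaChar_add_self, zero_add]
  have hd0 : d ≠ 0 := fun h => hne (by rw [hm, h, add_zero])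
  have hdd : d + d = 0 := thetaChar_add_self d
  have hy0 : m₁ + n 1 + n 2 = n 0 + d := by
    rw [hm, hm₂, show n 0 + n 1 + n 2 + d + n 1 + n 2 = n 0 + d + ((n 1 + n 2) + (n 1 + n 2)) by
      abel, thetaChar_add_self, add_zero]
  have hy1 : m₁ + n 0 + n 2 = n 1 + d := by
    rw [hm, hm₂, show n 0 + n 1 + n 2 + d + n 0 + n 2 = n 1 + d + ((n 0 + n 2) + (n 0 + n 2)) by
      abel, thetaChar_add_self, add_zero]
  have hy2 : m₁ + n 0 + n 1 = n 2 + d := by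
    rw [hm, hm₂, show n 0 + n 1 + n 2 + d + n 0 + n 1 = n 2 + d + ((n 0 + n 1) + (n 0 + n 1)) by
      abel, thetaChar_add_self, add_zero]
  have hback : ∀ a : ThetaChar 3, a + d + d = a := fun a => by rw [add_assoc, hdd, add_zero]
  have key : ∀ a b c : ThetaChar 3, a + b + c = m₂ →
      (∀ i : Fin 3, ∃ j : Fin 3, ![a, b, c] j = n (i.castLE (by decide)) ∨
        ![a, b, c] j = n (i.castLE (by decide)) + d) →
      (∀ j : Fin 3, ∃ i : Fin 3, ![a, b, c] j = n (i.castLE (by decide)) ∨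
        ![a, b, c] j = n (i.castLE (by decide)) + d) →
      theta (charLift m₁) τ 0 * D3 (a + d) (b + d) (c + d) τ =
        -zmodSign (translateSign ![a, b, c, m₂] d) * (theta (charLift m₂) τ 0 * D3 a b c τ) := by
    intro a b c habc h1 h2
    have hx : ∑ k, ![a, b, c, m₂] k = 0 := by
      rw [Fin.sum_univ_four, ← thetaChar_add_self m₂]
      exact congrArg (· + m₂) habc
    have hcast : ∀ j : Fin 3, ![a, b, c, m₂] j.castSucc = ![a, b, c] j := fun j => by
      fin_cases j <;> rfl
    have h := hA.detTheta_charLift_add hτ hd hd0 hx (by simpa only [hcast] using h1)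
      (by simpa only [hcast] using h2)
    have hv : ∀ k, ![a, b, c, m₂] k + d = ![a + d, b + d, c + d, m₁] k := fun k => by
      fin_cases k <;> simp [hm]
    simp only [hv] at h
    rw [D3_mul_theta, D3_mul_theta, h]
    ring
  have hforall : ∀ {P : Fin 3 → Prop}, P 0 → P 1 → P 2 → ∀ i, P i := fun h0 h1 h2 i => by
    fin_cases i <;> assumption
  have k1 := key (n 0) (n 1) (n 2) hm₂.symm
    (hforall ⟨0, Or.inl rfl⟩ ⟨1, Or.inl rfl⟩ ⟨2, Or.inl rfl⟩)
    (hforall ⟨0, Or.inl rfl⟩ ⟨1, Or.inl rfl⟩ ⟨2, Or.inl rfl⟩)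
  have k2 := key (n 0) (n 2 + d) (n 1 + d)
    (by rw [hm₂, ← hback (n 0 + n 1 + n 2)]; abel)
    (hforall ⟨0, Or.inl rfl⟩ ⟨2, Or.inr rfl⟩ ⟨1, Or.inr rfl⟩)
    (hforall ⟨0, Or.inl rfl⟩ ⟨2, Or.inr rfl⟩ ⟨1, Or.inr rfl⟩)
  have k3 := key (n 2 + d) (n 1) (n 0 + d)
    (by rw [hm₂, ← hback (n 0 + n 1 + n 2)]; abel)
    (hforall ⟨2, Or.inr rfl⟩ ⟨1, Or.inl rfl⟩ ⟨0, Or.inr rfl⟩)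
    (hforall ⟨2, Or.inr rfl⟩ ⟨1, Or.inl rfl⟩ ⟨0, Or.inr rfl⟩)
  have k4 := key (n 1 + d) (n 0 + d) (n 2)
    (by rw [hm₂, ← hback (n 0 + n 1 + n 2)]; abel)
    (hforall ⟨1, Or.inr rfl⟩ ⟨0, Or.inr rfl⟩ ⟨2, Or.inl rfl⟩)
    (hforall ⟨1, Or.inr rfl⟩ ⟨0, Or.inr rfl⟩ ⟨2, Or.inl rfl⟩)
  simp only [hback] at k2 k3 k4
  have hsign := translateSign_sum (n 0) (n 1) (n 2) d
  rw [← hm₂] at hsign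
  rw [hy0, hy1, hy2, hmd, charParity_eq, ← hsign, zmodSign_add, zmodSign_add, zmodSign_add]
  set θ₁ := theta (charLift m₁) τ 0
  set θ₂ := theta (charLift m₂) τ 0
  calc _ = (θ₁ * D3 (n 0 + d) (n 1 + d) (n 2 + d) τ) * (θ₁ * D3 (n 0 + d) (n 2) (n 1) τ) *
        (θ₁ * D3 (n 2) (n 1 + d) (n 0) τ) * (θ₁ * D3 (n 1) (n 0) (n 2 + d) τ) := by ring
    _ = _ := by
      rw [k1, k2, k3, k4]
      push_cast
      ring
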